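/- Let h' be the automorphism (x,y,z) ↦ (x + y + z/2, y + z, z) of C³. The centralizer of h' in Aut(C³) decomposes as a semidirect product C ⋉ (F₂ ⋉ F₁), where C = {(αx, αy, αz) : α ∈ C*}, F₁ = {exp(qD) : q ∈ ker D}, and F₂ = {exp(rE) : r ∈ ker E ∩ ker D} with E = ∂/∂x; i.e., every element of the centralizer factors uniquely as c ∘ f₂ ∘ f₁ with c ∈ C, f₂ ∈ F₂, f₁ ∈ F₁. -/

import Mathlib

open MvPolynomial

noncomputable section

/-- The polynomial ring ℂ[x,y,z], with x = X 0, y = X 1, z = X 2. -/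
abbrev R3 : Type := MvPolynomial (Fin 3) ℂ

/-- The derivation D = z·∂/∂y + y·∂/∂x, i.e. D x = y, D y = z, D z = 0. -/
def D : Derivation ℂ R3 R3 := mkDerivation ℂ ![X 1, X 2, 0]

/-- p = xz - (1/2)y² -/
def p : R3 := X 0 * X 2 - C (1/2) * X 1 ^ 2

/-- The exponential automorphism exp(qD) of ℂ³ (for q ∈ ker D), given by its
closed formula: since D q = 0, (qD)x = qy, (qD)²x = q²z, (qD)³x = 0, so
exp(qD) = (x + qy + q²z/2, y + qz, z). -/
def expMap (q : R3) : (Fin 3 → ℂ) → (Fin 3 → ℂ) :=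
  fun a => ![a 0 + eval a q * a 1 + eval a q ^ 2 * a 2 / 2,
             a 1 + eval a q * a 2, a 2]

/-- A map ℂ³ → ℂ³ given coordinatewise by polynomials. -/
def IsPolyMap (F : (Fin 3 → ℂ) → (Fin 3 → ℂ)) : Prop :=
  ∃ f : Fin 3 → R3, ∀ a i, F a i = eval a (f i)

/-- A polynomial automorphism of ℂ³: a polynomial map with a polynomial inverse. -/
def IsPolyAut (F : (Fin 3 → ℂ) → (Fin 3 → ℂ)) : Prop :=
  IsPolyMap F ∧ ∃ G, IsPolyMap G ∧ F ∘ G = id ∧ G ∘ F = id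

/-- h' = exp(D) : (x,y,z) ↦ (x + y + z/2, y + z, z). -/
def h'map : (Fin 3 → ℂ) → (Fin 3 → ℂ) :=
  fun a => ![a 0 + a 1 + a 2 / 2, a 1 + a 2, a 2]

/-- C = {(αx, αy, αz) : α ∈ ℂ*} -/
def Cset : Set ((Fin 3 → ℂ) → (Fin 3 → ℂ)) :=
  {F | ∃ α : ℂ, α ≠ 0 ∧ F = fun a => ![α * a 0, α * a 1, α * a 2]}

/-- F₁ = {exp(qD) : q ∈ ker D} -/
def F1set : Set ((Fin 3 → ℂ) → (Fin 3 → ℂ)) :=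
  {F | ∃ q : R3, D q = 0 ∧ F = expMap q}

/-- F₂ = {exp(rE) : r ∈ ker E ∩ ker D}, where E = ∂/∂x; since E r = 0,
exp(rE) is the translation (x + r, y, z). -/
def F2set : Set ((Fin 3 → ℂ) → (Fin 3 → ℂ)) :=
  {F | ∃ r : R3, pderiv 0 r = 0 ∧ D r = 0 ∧ F = fun a => ![a 0 + eval a r, a 1, a 2]}

/-- The flow exp(tD) of `D` as a map of ℂ³, for a scalar `t`. -/
def flow (t : ℂ) (a : Fin 3 → ℂ) : Fin 3 → ℂ :=
  ![a 0 + t * a 1 + t ^ 2 * a 2 / 2, a 1 + t * a 2, a 2]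

lemma expMap_apply (q : R3) (a : Fin 3 → ℂ) : expMap q a = flow (eval a q) a := rfl

lemma flow_zero (a : Fin 3 → ℂ) : flow 0 a = a := by
  ext i; fin_cases i <;> simp [flow]

lemma flow_flow (s t : ℂ) (a : Fin 3 → ℂ) : flow s (flow t a) = flow (s + t) a := by
  ext i; fin_cases i <;> simp [flow] <;> ring

lemma h'map_eq_flow : h'map = flow 1 := by
  ext a i; fin_cases i <;> simp [flow, h'map]

/-- Pullback of polynomials along the orbit `t ↦ flow t a`, as polynomials in `t`. -/
def orbitPullback (a : Fin 3 → ℂ) : R3 →ₐ[ℂ] Polynomial ℂ :=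
  aeval ![Polynomial.C (a 0) + Polynomial.X * Polynomial.C (a 1)
      + Polynomial.X ^ 2 * Polynomial.C (a 2 / 2),
    Polynomial.C (a 1) + Polynomial.X * Polynomial.C (a 2), Polynomial.C (a 2)]

lemma eval_orbitPullback (a : Fin 3 → ℂ) (t : ℂ) (q : R3) :
    (orbitPullback a q).eval t = eval (flow t a) q := by
  induction q using MvPolynomial.induction_on with
  | C c => simp [orbitPullback]
  | add f g hf hg => simp [hf, hg]
  | mul_X f i hf =>
    simp only [map_mul, Polynomial.eval_mul, hf, eval_X]
    congr 1
    fin_cases i <;> simp [orbitPullback, flow] <;> ring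

lemma derivative_orbitPullback (a : Fin 3 → ℂ) (q : R3) :
    Polynomial.derivative (orbitPullback a q) = orbitPullback a (D q) := by
  induction q using MvPolynomial.induction_on with
  | C c =>
    have h : D (C c) = 0 := D.map_algebraMap c
    simp [orbitPullback, h]
  | add f g hf hg => simp [hf, hg]
  | mul_X f i hf =>
    have h : Polynomial.derivative (orbitPullback a (X i)) = orbitPullback a (D (X i)) := by
      fin_cases i <;> simp [orbitPullback, D]
      have h2 : 2 * Polynomial.C (a 2 / 2) = Polynomial.C (a 2) := by
        rw [← Polynomial.C_ofNat, ← Polynomial.C_mul]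
        congr 1
        ring
      linear_combination Polynomial.X * h2
    simp only [map_mul, Polynomial.derivative_mul, Derivation.leibniz, map_add, smul_eq_mul, hf, h]
    ring

lemma D_eq_zero_iff (q : R3) : D q = 0 ↔ ∀ t a, eval (flow t a) q = eval a q := by
  constructor
  · intro h t a
    have h1 := derivative_orbitPullback a q
    rw [h, map_zero] at h1
    have h2 := Polynomial.eq_C_of_derivative_eq_zero h1
    have h3 := eval_orbitPullback a 0 q
    rw [flow_zero] at h3
    rw [← eval_orbitPullback, ← h3, h2]
    simp
  · intro h
    apply MvPolynomial.funext
    intro a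
    have h1 : orbitPullback a q = Polynomial.C (eval a q) := by
      apply Polynomial.funext
      intro t
      rw [eval_orbitPullback, h, Polynomial.eval_C]
    have h2 := derivative_orbitPullback a q
    rw [h1, Polynomial.derivative_C] at h2
    rw [← flow_zero a, ← eval_orbitPullback, ← h2]
    simp

lemma eval_aeval (f : Fin 3 → R3) (q : R3) (a : Fin 3 → ℂ) :
    eval a (aeval f q) = eval (fun i => eval a (f i)) q := by
  rw [← coe_aeval_eq_eval, RingHom.coe_coe, ← AlgHom.comp_apply, comp_aeval,
    ← coe_aeval_eq_eval, RingHom.coe_coe]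

/-- The plinth ideal of `D` is generated by `z`. -/
lemma X_two_dvd_of_flow (u s : R3) (h : ∀ t a, eval (flow t a) u = eval a u + t * eval a s) :
    (X 2 : R3) ∣ s := by
  set v : R3 := aeval ![X 0, -X 1, X 2] u with hv
  have hval (a : Fin 3 → ℂ) : eval a v = eval ![a 0, -a 1, a 2] u := by
    rw [hv, eval_aeval]
    congr 2
    ext i; fin_cases i <;> simp
  have hmul : (X 2 : R3) * (X 1 * s) = X 2 * (X 2 * (C (1 / 2) * (u - v))) := by
    apply MvPolynomial.funext
    intro a
    simp only [map_mul, eval_X, map_sub, eval_C]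
    rcases eq_or_ne (a 2) 0 with h0 | h0
    · simp [h0]
    · have hf : flow (-2 * a 1 / a 2) a = ![a 0, -a 1, a 2] := by
        ext i; fin_cases i <;> simp [flow] <;> field_simp <;> ring
      rw [hval, ← hf, h]
      field_simp
      ring
  have hdvd : (X 2 : R3) ∣ X 1 * s := ⟨_, mul_left_cancel₀ (X_ne_zero 2) hmul⟩
  refine ((X_prime (R := ℂ) (i := (2 : Fin 3))).dvd_or_dvd hdvd).resolve_left ?_
  rintro ⟨k, hk⟩
  have := congrArg (eval ![(0 : ℂ), 1, 0]) hk
  simp at this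

lemma commute_flow {F : (Fin 3 → ℂ) → (Fin 3 → ℂ)} (hF : IsPolyMap F)
    (hcomm : F ∘ h'map = h'map ∘ F) (t : ℂ) (a : Fin 3 → ℂ) : F (flow t a) = flow t (F a) := by
  rw [h'map_eq_flow] at hcomm
  have hnat (n : ℕ) : F (flow n a) = flow n (F a) := by
    induction n with
    | zero => simp [flow_zero]
    | succ n ih =>
      have := congrFun hcomm (flow n a)
      simp only [Function.comp_apply, flow_flow, ih] at this
      rw [Nat.cast_succ, add_comm]
      exact this
  obtain ⟨f, hf⟩ := hF
  ext i
  have key : orbitPullback a (f i) = orbitPullback (F a) (X i) := by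
    apply Polynomial.eq_of_infinite_eval_eq
    apply (Set.infinite_range_of_injective (Nat.cast_injective (R := ℂ))).mono
    rintro _ ⟨n, rfl⟩
    simp only [Set.mem_ofPred_eq, eval_orbitPullback, ← hf, eval_X, hnat]
  rw [hf, ← eval_orbitPullback, key, eval_orbitPullback, eval_X]

lemma X_two_dvd_of_commute {F : (Fin 3 → ℂ) → (Fin 3 → ℂ)} {f : Fin 3 → R3}
    (hf : ∀ a i, F a i = eval a (f i)) (hflow : ∀ t a, F (flow t a) = flow t (F a)) :
    (X 2 : R3) ∣ f 2 := by
  apply X_two_dvd_of_flow (f 1)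
  intro t a
  rw [← hf, hflow]
  simp [flow, hf]

lemma pderiv_zero_aeval (r g : R3) :
    pderiv 0 (aeval ![X 0 + r, X 1, X 2] g : R3)
      = aeval ![X 0 + r, X 1, X 2] (pderiv 0 g) * (1 + pderiv 0 r) := by
  induction g using MvPolynomial.induction_on with
  | C c => simp
  | add f g hf hg => simp only [map_add, hf, hg, add_mul]
  | mul_X f i hf =>
    simp only [map_mul, Derivation.leibniz, map_add, smul_eq_mul, hf]
    fin_cases i <;> simp [pderiv_X] <;> ring

lemma D_apply (r : R3) : D r = X 1 * pderiv 0 r + X 2 * pderiv 1 r := by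
  have h : D = (X 1 : R3) • (pderiv 0 : Derivation ℂ R3 R3)
      + (X 2 : R3) • (pderiv 1 : Derivation ℂ R3 R3) := by
    apply MvPolynomial.derivation_ext
    intro i
    fin_cases i <;> simp [D, pderiv_X]
  rw [h]
  simp

lemma pderiv_zero_eq_zero_of_section {r g : R3} (hr : D r = 0)
    (hg : ∀ a : Fin 3 → ℂ, eval ![a 0 + eval a r, a 1, a 2] g = a 0) : pderiv 0 r = 0 := by
  have hX : (aeval ![X 0 + r, X 1, X 2] g : R3) = X 0 := by
    apply MvPolynomial.funext
    intro a
    rw [eval_aeval, eval_X, ← hg a]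
    congr 2
    ext i; fin_cases i <;> simp
  have h1 := pderiv_zero_aeval r g
  rw [hX, pderiv_X_self] at h1
  have hu : IsUnit (1 + pderiv 0 r) := IsUnit.of_mul_eq_one_right _ h1.symm
  obtain ⟨c, -, hc⟩ := MvPolynomial.isUnit_iff_eq_C_of_isReduced.mp hu
  have hk : pderiv 0 r = C (c - 1) := by
    rw [map_sub, ← hc]; simp
  rw [D_apply, hk] at hr
  have := congrArg (eval ![(0 : ℂ), 1, 0]) hr
  simp at this
  rw [hk, this, map_zero]

lemma exists_smul_X_two {F : (Fin 3 → ℂ) → (Fin 3 → ℂ)} {f : Fin 3 → R3}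
    (haut : IsPolyAut F) (hcomm : F ∘ h'map = h'map ∘ F)
    (hf : ∀ a i, F a i = eval a (f i)) : ∃ α : ℂ, α ≠ 0 ∧ f 2 = C α * X 2 := by
  obtain ⟨hF, G, hG, hFG, hGF⟩ := haut
  obtain ⟨g, hg⟩ := id hG
  have hGcomm : G ∘ h'map = h'map ∘ G := by
    calc G ∘ h'map = G ∘ h'map ∘ (F ∘ G) := by rw [hFG, Function.comp_id]
      _ = G ∘ (h'map ∘ F) ∘ G := rfl
      _ = (G ∘ F) ∘ h'map ∘ G := by rw [← hcomm]; rfl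
      _ = h'map ∘ G := by rw [hGF, Function.id_comp]
  obtain ⟨k, hk⟩ := X_two_dvd_of_commute hf (commute_flow hF hcomm)
  obtain ⟨l, hl⟩ := X_two_dvd_of_commute hg (commute_flow hG hGcomm)
  have hz : (X 2 : R3) * (k * aeval f l) = X 2 * 1 := by
    apply MvPolynomial.funext
    intro a
    have h1 : eval (F a) (g 2) = a 2 := by
      rw [← hg]; exact congrFun (congrFun hGF a) 2
    have hFa : F a = fun i => eval a (f i) := _root_.funext (hf a)
    rw [hl, map_mul, eval_X, hf, hk, hFa] at h1
    rw [map_mul, map_mul, eval_aeval, ← mul_assoc, mul_one, eval_X]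
    simpa only [map_mul, eval_X] using h1
  have hu : IsUnit k := IsUnit.of_mul_eq_one _ (mul_left_cancel₀ (X_ne_zero 2) hz)
  obtain ⟨α, hα, hc⟩ := MvPolynomial.isUnit_iff_eq_C_of_isReduced.mp hu
  exact ⟨α, hα.ne_zero, by rw [hk, hc, mul_comm]⟩

lemma exists_normal_form {F : (Fin 3 → ℂ) → (Fin 3 → ℂ)}
    (haut : IsPolyAut F) (hcomm : F ∘ h'map = h'map ∘ F) :
    ∃ (α : ℂ) (q r : R3), α ≠ 0 ∧ D q = 0 ∧ D r = 0 ∧ pderiv 0 r = 0 ∧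
      F = (fun a => ![α * a 0, α * a 1, α * a 2]) ∘
        (fun a => ![a 0 + eval a r, a 1, a 2]) ∘ expMap q := by
  obtain ⟨f, hf⟩ := haut.1
  obtain ⟨α, hα, h2⟩ := exists_smul_X_two haut hcomm hf
  have hflow := commute_flow haut.1 hcomm
  have hf2 (a : Fin 3 → ℂ) : eval a (f 2) = α * a 2 := by simp [h2]
  have hf1 (t : ℂ) (a : Fin 3 → ℂ) :
      eval (flow t a) (f 1) = eval a (f 1) + t * (α * a 2) := by
    rw [← hf, hflow]; simp [flow, hf, hf2]
  have hf0 (t : ℂ) (a : Fin 3 → ℂ) :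
      eval (flow t a) (f 0) = eval a (f 0) + t * eval a (f 1) + t ^ 2 * (α * a 2) / 2 := by
    rw [← hf, hflow]; simp [flow, hf, hf2]
  obtain ⟨q, hq⟩ : (X 2 : R3) ∣ C α⁻¹ * f 1 - X 1 := by
    apply X_two_dvd_of_flow (C α⁻¹ * f 0 - X 0)
    intro t a
    simp only [map_sub, map_mul, eval_C, eval_X, hf0]
    simp [flow]
    field_simp
    ring
  have hqval (a : Fin 3 → ℂ) : eval a (f 1) = α * (a 1 + a 2 * eval a q) := by
    have := congrArg (eval a) hq
    simp only [map_sub, map_mul, eval_C, eval_X] at this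
    field_simp at this
    linear_combination this
  have hDq : D q = 0 := by
    have hD : D (C α⁻¹ * f 1 - X 1) = 0 := by
      rw [D_eq_zero_iff]
      intro t a
      simp only [map_sub, map_mul, eval_C, eval_X, hf1]
      simp [flow]
      field_simp
      ring
    rw [hq, Derivation.leibniz, show D (X 2) = 0 by simp [D], smul_zero, add_zero,
      smul_eq_mul] at hD
    exact (mul_eq_zero.mp hD).resolve_left (X_ne_zero 2)
  have hqinv := (D_eq_zero_iff q).mp hDq
  set r : R3 := C α⁻¹ * f 0 - (X 0 + q * X 1 + C (1 / 2) * q ^ 2 * X 2) with hr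
  have hDr : D r = 0 := by
    rw [D_eq_zero_iff]
    intro t a
    simp only [hr, map_sub, map_mul, map_add, map_pow, eval_C, eval_X, hf0, hqinv, hqval]
    simp [flow]
    field_simp
    ring
  have hrinv := (D_eq_zero_iff r).mp hDr
  have hF : F = (fun a => ![α * a 0, α * a 1, α * a 2]) ∘
      (fun a => ![a 0 + eval a r, a 1, a 2]) ∘ expMap q := by
    ext a i
    rw [hf]
    simp only [Function.comp_apply, expMap_apply, hrinv]
    fin_cases i
    · simp [hr, flow]
      field_simp
      ring
    · simp only [Fin.mk_one, hqval, flow]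
      simp [mul_comm (a 2)]
    · simp [hf2, flow]
  refine ⟨α, q, r, hα, hDq, hDr, ?_, hF⟩
  obtain ⟨-, G, ⟨g, hg⟩, hFG, hGF⟩ := haut
  apply pderiv_zero_eq_zero_of_section (g := aeval (fun i => aeval (fun j => C α * X j) (g i))
    (X 0 + q * X 1 + C (1 / 2) * q ^ 2 * X 2)) hDr
  intro a
  set b := flow (-eval a q) a with hb
  have hFb : F b = fun j => α * (![a 0 + eval a r, a 1, a 2] : Fin 3 → ℂ) j := by
    have : expMap q b = a := by
      rw [expMap_apply, hb, hqinv, flow_flow, add_neg_cancel, flow_zero]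
    rw [hF]
    simp only [Function.comp_apply, this]
    ext i; fin_cases i <;> simp
  have hGb : (fun i => eval (F b) (g i)) = b := by
    ext i
    rw [← hg]
    exact congrFun (congrFun hGF b) i
  rw [eval_aeval]
  simp only [eval_aeval, map_mul, eval_C, eval_X, ← hFb, hGb]
  simp only [map_mul, map_add, map_pow, eval_C, eval_X]
  rw [hb, hqinv]
  simp [flow]
  ring

/-- the centralizer of h' in Aut(ℂ³) is the semidirect product
C ⋉ (F₂ ⋉ F₁): every polynomial automorphism commuting with h' factors uniquely
as c ∘ f₂ ∘ f₁ with c ∈ C, f₂ ∈ F₂, f₁ ∈ F₁. -/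
theorem stmt_11 (F : (Fin 3 → ℂ) → (Fin 3 → ℂ))
    (haut : IsPolyAut F) (hcomm : F ∘ h'map = h'map ∘ F) :
    ∃! t : ((Fin 3 → ℂ) → (Fin 3 → ℂ)) × ((Fin 3 → ℂ) → (Fin 3 → ℂ)) ×
           ((Fin 3 → ℂ) → (Fin 3 → ℂ)),
      t.1 ∈ Cset ∧ t.2.1 ∈ F2set ∧ t.2.2 ∈ F1set ∧ F = t.1 ∘ t.2.1 ∘ t.2.2 := by
  obtain ⟨α, q, r, hα, hq, hr, hr0, hF⟩ := exists_normal_form haut hcomm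
  refine ⟨(fun a => ![α * a 0, α * a 1, α * a 2], fun a => ![a 0 + eval a r, a 1, a 2],
    expMap q), ⟨⟨α, hα, rfl⟩, ⟨r, hr0, hr, rfl⟩, ⟨q, hq, rfl⟩, hF⟩, ?_⟩
  rintro ⟨c, f₂, f₁⟩ ⟨⟨β, hβ, hc⟩, ⟨s, -, hs, hf₂⟩, ⟨q', hq', hf₁⟩, hF'⟩
  simp only at hc hf₂ hf₁ hF'
  subst hc hf₂ hf₁
  have h (a : Fin 3 → ℂ) := congrFun (hF'.symm.trans hF) a
  simp only [Function.comp_apply, expMap_apply, (D_eq_zero_iff r).mp hr,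
    (D_eq_zero_iff s).mp hs] at h
  have hαβ : β = α := by
    have := congrFun (h ![0, 0, 1]) 2
    simpa [flow] using this
  subst hαβ
  have hqq : q' = q := by
    apply mul_left_cancel₀ (X_ne_zero (R := ℂ) (2 : Fin 3))
    apply MvPolynomial.funext
    intro a
    have := congrFun (h a) 1
    simp [flow, hα] at this
    simpa [or_comm] using this
  subst hqq
  have hsr : s = r := by
    apply MvPolynomial.funext
    intro a
    have := congrFun (h a) 0
    simpa [hα] using this
  subst hsr
  rfl
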